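/- Let I = (V,E,Q,Φ) and I' = (V,E',Q,Φ') be MRF instances on the same vertex set with n = |V|, where φ'_a = φ_a for all a ∈ V ∪ (E∩E'), and |E ⊕ E'| ≤ L (E ⊕ E' the symmetric difference). Assume I' satisfies the Dobrushin–Shlosman condition with constant δ > 0. Let S = ∪_{{u,v}∈E⊕E'} {u,v}. Then the one-step local coupling for edge update (X_t,Y_t)_{t≥0} between the Gibbs sampling chains on I and I' satisfies, for all σ, τ ∈ Q^V and all t ≥ 1, E[H(X_t,Y_t) | X_{t−1} = σ ∧ Y_{t−1} = τ] ≤ (1 − δ/n)·H(σ,τ) + 4L/n, where H is the Hamming distance on Q^V. -/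

import Mathlib

open Finset
open scoped ENNReal

/-- Exponential on `ℝ ∪ {−∞}` (modeled as `WithBot ℝ`), with `exp(−∞) = 0`. -/
noncomputable def expB (x : WithBot ℝ) : ℝ := WithBot.recBotCoe 0 Real.exp x

/-- Total variation distance between two distributions on a finite set. -/
noncomputable def tvDist {Q : Type*} [Fintype Q] (μ ν : Q → ℝ) : ℝ :=
  2⁻¹ * ∑ x, |μ x - ν x|

/-- `D` is a coupling of the distributions `μ` and `ν` on a finite set. -/
def IsCoupling {Q : Type*} [Fintype Q] (μ ν : Q → ℝ) (D : Q → Q → ℝ) : Prop :=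
  (∀ c c', 0 ≤ D c c') ∧ (∀ c, ∑ c', D c c' = μ c) ∧ (∀ c', ∑ c, D c c' = ν c')

/-- `D` is an optimal coupling of `μ` and `ν`: a coupling maximizing the probability
of agreement of the two coordinates. -/
def IsOptimalCoupling {Q : Type*} [Fintype Q] (μ ν : Q → ℝ) (D : Q → Q → ℝ) : Prop :=
  IsCoupling μ ν D ∧
    ∀ D' : Q → Q → ℝ, IsCoupling μ ν D' → ∑ c, D' c c ≤ ∑ c, D c c

/-- Distribution of a finite-state Markov chain with transition kernel `P` after `t` steps,
started from the initial distribution `init`. -/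
noncomputable def chainDist {S : Type*} [Fintype S] (P : S → S → ℝ) (init : S → ℝ) :
    ℕ → S → ℝ
  | 0 => init
  | t + 1 => fun s' => ∑ s, chainDist P init t s * P s s'

/-- Point mass at `s0`. -/
noncomputable def initDelta {S : Type*} [DecidableEq S] (s0 : S) : S → ℝ :=
  fun s => if s = s0 then 1 else 0

/-- Transition kernel of a coupled pair of single-site (Gibbs-sampling style) chains:
a uniformly random vertex `v` is picked, all other coordinates of both copies are copied,
and the pair of new values at `v` is drawn from the local coupling `Dloc v`. -/
noncomputable def pairKernel {V Q : Type*} [Fintype V] [Fintype Q]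
    (Dloc : V → (V → Q) → (V → Q) → Q → Q → ℝ)
    (p p' : (V → Q) × (V → Q)) : ℝ := by
  classical
  exact (Fintype.card V : ℝ)⁻¹ * ∑ v,
    (if (∀ u, u ≠ v → p'.1 u = p.1 u) ∧ (∀ u, u ≠ v → p'.2 u = p.2 u)
      then Dloc v p.1 p.2 (p'.1 v) (p'.2 v) else 0)

/-- The resampling probability `p(c)` used in the local coupling for Hamiltonian update. -/
noncomputable def pResample {Q : Type*} (μ μ' : Q → ℝ) (c : Q) : ℝ := by
  classical
  exact if μ c ≤ μ' c then 0 else (μ c - μ' c) / μ c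

/-- The resampling distribution `ν` used in the local coupling for Hamiltonian update. -/
noncomputable def nuResample {Q : Type*} [Fintype Q] (μ μ' : Q → ℝ) (b : Q) : ℝ :=
  max 0 (μ' b - μ b) / ∑ x, max 0 (μ x - μ' x)

/-- The joint law of the local coupling for Hamiltonian update: first `(c,c')` is drawn from
the optimal coupling `Dopt`, then with probability `pResample μ μ' c'` the second coordinate
is resampled from `nuResample μ μ'`. -/
noncomputable def hamCoupling {Q : Type*} [Fintype Q] (μ μ' : Q → ℝ)
    (Dopt : Q → Q → ℝ) (c d : Q) : ℝ :=
  Dopt c d * (1 - pResample μ μ' d) +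
    nuResample μ μ' d * ∑ c', Dopt c c' * pResample μ μ' c'

/-- Indicator (as a real number) of the event `v ∈ Γ⁺(D)`, where `D` is the set of
disagreements between the two coordinates of the pair state `p`. -/
noncomputable def indNbr {V Q : Type*} [Fintype V] (G : SimpleGraph V)
    (p : (V → Q) × (V → Q)) (v : V) : ℝ := by
  classical
  exact if (∃ u, (u = v ∨ G.Adj v u) ∧ p.1 u ≠ p.2 u) then 1 else 0

/-- `v` is incident to an edge of the symmetric difference of the edge sets of `G` and `G'`. -/
def inS {V : Type*} (G G' : SimpleGraph V) (v : V) : Prop :=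
  ∃ u, (G.Adj v u ∧ ¬ G'.Adj v u) ∨ (G'.Adj v u ∧ ¬ G.Adj v u)

/-- Indicator (as a real number) of the event `v ∈ S ∪ Γ_G⁺(D)`. -/
noncomputable def indSnbr {V Q : Type*} [Fintype V] (G G' : SimpleGraph V)
    (p : (V → Q) × (V → Q)) (v : V) : ℝ := by
  classical
  exact if inS G G' v ∨ (∃ u, (u = v ∨ G.Adj v u) ∧ p.1 u ≠ p.2 u) then 1 else 0

/-- Conditional marginal distribution `μ_{v,I}(·|τ)` of the MRF at vertex `v` given the
configuration `τ` on its neighborhood, where the MRF on the graph `G` has vertex potentials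
`φ` and (symmetric) edge potentials `ψ` with values in `ℝ ∪ {−∞}`. -/
noncomputable def margW {V Q : Type*} [Fintype V] [Fintype Q]
    (G : SimpleGraph V) [DecidableRel G.Adj]
    (φ : V → Q → WithBot ℝ) (ψ : V → V → Q → Q → WithBot ℝ)
    (v : V) (τ : V → Q) (c : Q) : ℝ :=
  expB (φ v c + ∑ u ∈ G.neighborFinset v, ψ u v (τ u) c) /
    ∑ a, expB (φ v a + ∑ u ∈ G.neighborFinset v, ψ u v (τ u) a)

/-- The influence matrix `A_I(u,v)`: the largest total variation distance between the
conditional marginals at `v` induced by two boundary configurations differing only at `u`,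
when `{u,v}` is an edge, and `0` otherwise. -/
noncomputable def influence {V Q : Type*} [Fintype V] [Fintype Q]
    (G : SimpleGraph V) [DecidableRel G.Adj]
    (φ : V → Q → WithBot ℝ) (ψ : V → V → Q → Q → WithBot ℝ) (u v : V) : ℝ := by
  classical
  exact if G.Adj u v then
      sSup {d : ℝ | ∃ σ τ : V → Q, (∀ w, w ≠ u → σ w = τ w) ∧
        d = tvDist (margW G φ ψ v σ) (margW G φ ψ v τ)}
    else 0

/-- The Dobrushin–Shlosman condition with constant `δ`. -/
def DobrushinCondition {V Q : Type*} [Fintype V] [Fintype Q]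
    (G : SimpleGraph V) [DecidableRel G.Adj]
    (φ : V → Q → WithBot ℝ) (ψ : V → V → Q → Q → WithBot ℝ) (δ : ℝ) : Prop :=
  ∀ u : V, ∑ v, influence G φ ψ u v ≤ 1 - δ

/-- The transition kernel of the Gibbs sampling (Glauber dynamics) chain on the MRF:
a uniformly random vertex is picked and its spin resampled from the conditional marginal. -/
noncomputable def gibbsStep {V Q : Type*} [Fintype V] [Fintype Q]
    (G : SimpleGraph V) [DecidableRel G.Adj]
    (φ : V → Q → WithBot ℝ) (ψ : V → V → Q → Q → WithBot ℝ)
    (σ σ' : V → Q) : ℝ := by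
  classical
  exact (Fintype.card V : ℝ)⁻¹ *
    ∑ v, (if ∀ u, u ≠ v → σ' u = σ u then margW G φ ψ v σ (σ' v) else 0)

/-- Unnormalized Gibbs weight `exp(H(σ))` of a configuration. -/
noncomputable def gibbsWeight {V Q : Type*} [Fintype V] [DecidableEq V] [Fintype Q]
    (G : SimpleGraph V) [DecidableRel G.Adj] [Fintype G.edgeSet]
    (φ : V → Q → WithBot ℝ) (ψ : V → V → Q → Q → WithBot ℝ)
    (hψsym : ∀ u v c c', ψ u v c c' = ψ v u c' c) (σ : V → Q) : ℝ :=
  expB ((∑ v, φ v (σ v)) +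
    ∑ e ∈ G.edgeFinset,
      Sym2.lift ⟨fun u w => ψ u w (σ u) (σ w), fun u w => hψsym u w (σ u) (σ w)⟩ e)

/-- The Gibbs distribution `μ_I` of the MRF. -/
noncomputable def gibbsMeasure {V Q : Type*} [Fintype V] [DecidableEq V] [Fintype Q]
    (G : SimpleGraph V) [DecidableRel G.Adj] [Fintype G.edgeSet]
    (φ : V → Q → WithBot ℝ) (ψ : V → V → Q → Q → WithBot ℝ)
    (hψsym : ∀ u v c c', ψ u v c c' = ψ v u c' c) (σ : V → Q) : ℝ :=
  gibbsWeight G φ ψ hψsym σ / ∑ σ' : V → Q, gibbsWeight G φ ψ hψsym σ'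

/-- Distance `|x − y| ∈ [0,∞]` on `ℝ ∪ {−∞}`: `0` if both are `−∞`, `∞` if exactly one is. -/
noncomputable def dB (x y : WithBot ℝ) : ℝ≥0∞ :=
  WithBot.recBotCoe (WithBot.recBotCoe (0 : ℝ≥0∞) (fun _ => (⊤ : ℝ≥0∞)) y)
    (fun r => WithBot.recBotCoe (⊤ : ℝ≥0∞) (fun s => ENNReal.ofReal |r - s|) y) x

/-- The contribution of vertex `v` to the Hamiltonian distance:
`‖φ_v − φ'_v‖₁ + Σ_{e = {u,v} ∈ E} ‖φ_e − φ'_e‖₁`. -/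
noncomputable def dVert {V Q : Type*} [Fintype V] [Fintype Q]
    (G : SimpleGraph V) [DecidableRel G.Adj]
    (φ φ' : V → Q → WithBot ℝ) (ψ ψ' : V → V → Q → Q → WithBot ℝ) (v : V) : ℝ≥0∞ :=
  (∑ c, dB (φ v c) (φ' v c)) +
    ∑ u ∈ G.neighborFinset v, ∑ c, ∑ c', dB (ψ u v c c') (ψ' u v c c')

/-- Hamiltonian distance `d_Ham(I,I') = Σ_v ‖φ_v − φ'_v‖₁ + Σ_{e∈E} ‖φ_e − φ'_e‖₁`
(the edge sum is written as half the sum over ordered adjacent pairs). -/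
noncomputable def dHamiltonian {V Q : Type*} [Fintype V] [Fintype Q]
    (G : SimpleGraph V) [DecidableRel G.Adj]
    (φ φ' : V → Q → WithBot ℝ) (ψ ψ' : V → V → Q → Q → WithBot ℝ) : ℝ≥0∞ :=
  (∑ v, ∑ c, dB (φ v c) (φ' v c)) +
    2⁻¹ * ∑ u, ∑ v ∈ G.neighborFinset u, ∑ c, ∑ c', dB (ψ u v c c') (ψ' u v c c')

/-- The filter probability `p̂_v = min{2(‖φ_v − φ'_v‖₁ + Σ_{e∋v} ‖φ_e − φ'_e‖₁), 1}`. -/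
noncomputable def pHat {V Q : Type*} [Fintype V] [Fintype Q]
    (G : SimpleGraph V) [DecidableRel G.Adj]
    (φ φ' : V → Q → WithBot ℝ) (ψ ψ' : V → V → Q → Q → WithBot ℝ) (v : V) : ℝ :=
  (min (2 * dVert G φ φ' ψ ψ' v) 1).toReal

section Coupling

variable {Q : Type*} [Fintype Q]

lemma tvDist_nonneg (μ ν : Q → ℝ) : 0 ≤ tvDist μ ν := by
  unfold tvDist
  positivity

lemma tvDist_self (μ : Q → ℝ) : tvDist μ μ = 0 := by
  simp [tvDist]

lemma tvDist_triangle (μ ν ρ : Q → ℝ) : tvDist μ ρ ≤ tvDist μ ν + tvDist ν ρ := by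
  unfold tvDist
  rw [← mul_add, ← Finset.sum_add_distrib]
  gcongr with x
  exact abs_sub_le _ _ _

lemma sum_min_eq_one_sub_tvDist {μ ν : Q → ℝ} (hμ : ∑ c, μ c = 1) (hν : ∑ c, ν c = 1) :
    ∑ c, min (μ c) (ν c) = 1 - tvDist μ ν := by
  have h : ∀ c, min (μ c) (ν c) = 2⁻¹ * (μ c + ν c) - 2⁻¹ * |μ c - ν c| := by
    intro c
    rcases le_total (μ c) (ν c) with h | h
    · rw [min_eq_left h, abs_of_nonpos (by linarith)]; ring
    · rw [min_eq_right h, abs_of_nonneg (by linarith)]; ring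
  simp only [h, Finset.sum_sub_distrib, ← Finset.mul_sum, Finset.sum_add_distrib, hμ, hν, tvDist]
  norm_num

/-- Two distributions admit a coupling that agrees with probability at least
`1 - tvDist μ ν`. -/
lemma exists_isCoupling_one_sub_tvDist_le {μ ν : Q → ℝ}
    (hμ0 : ∀ c, 0 ≤ μ c) (hν0 : ∀ c, 0 ≤ ν c)
    (hμ : ∑ c, μ c = 1) (hν : ∑ c, ν c = 1) :
    ∃ D : Q → Q → ℝ, IsCoupling μ ν D ∧ 1 - tvDist μ ν ≤ ∑ c, D c c := by
  classical
  set p : Q → ℝ := fun c => μ c - min (μ c) (ν c) with hp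
  set q : Q → ℝ := fun c => ν c - min (μ c) (ν c) with hq
  have hp0 : ∀ c, 0 ≤ p c := fun c => sub_nonneg.2 (min_le_left _ _)
  have hq0 : ∀ c, 0 ≤ q c := fun c => sub_nonneg.2 (min_le_right _ _)
  have hpT : ∑ c, p c = tvDist μ ν := by
    simp only [hp, Finset.sum_sub_distrib, hμ, sum_min_eq_one_sub_tvDist hμ hν]; ring
  have hqT : ∑ c, q c = tvDist μ ν := by
    simp only [hq, Finset.sum_sub_distrib, hν, sum_min_eq_one_sub_tvDist hμ hν]; ring
  have cancel : ∀ r : Q → ℝ, (∀ c, 0 ≤ r c) → ∑ c, r c = tvDist μ ν →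
      ∀ c, r c * tvDist μ ν / tvDist μ ν = r c := by
    intro r hr hrT c
    rcases eq_or_ne (tvDist μ ν) 0 with h | h
    · have : r c = 0 :=
        (Finset.sum_eq_zero_iff_of_nonneg (fun i _ => hr i)).1 (hrT.trans h) c (Finset.mem_univ c)
      simp [this]
    · field_simp
  have hT := tvDist_nonneg μ ν
  have hterm : ∀ c c', 0 ≤ p c * q c' / tvDist μ ν := fun c c' =>
    div_nonneg (mul_nonneg (hp0 c) (hq0 c')) hT
  refine ⟨fun c c' => (if c = c' then min (μ c) (ν c) else 0) + p c * q c' / tvDist μ ν,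
    ⟨fun c c' => ?_, fun c => ?_, fun c' => ?_⟩, ?_⟩
  · refine add_nonneg ?_ (hterm c c')
    split_ifs
    · exact le_min (hμ0 c) (hν0 c)
    · exact le_rfl
  · rw [Finset.sum_add_distrib, ← Finset.sum_div, ← Finset.mul_sum, hqT, cancel p hp0 hpT]
    simp [hp]
  · rw [Finset.sum_add_distrib, ← Finset.sum_div, ← Finset.sum_mul, hpT, mul_comm,
      cancel q hq0 hqT]
    simp [hq]
  · rw [← sum_min_eq_one_sub_tvDist hμ hν]
    refine Finset.sum_le_sum fun c _ => ?_
    simpa using hterm c c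

lemma IsOptimalCoupling.one_sub_tvDist_le {μ ν : Q → ℝ} {D : Q → Q → ℝ}
    (hD : IsOptimalCoupling μ ν D) (hμ0 : ∀ c, 0 ≤ μ c) (hν0 : ∀ c, 0 ≤ ν c)
    (hμ : ∑ c, μ c = 1) (hν : ∑ c, ν c = 1) : 1 - tvDist μ ν ≤ ∑ c, D c c := by
  obtain ⟨D', hD', h⟩ := exists_isCoupling_one_sub_tvDist_le hμ0 hν0 hμ hν
  exact h.trans (hD.2 D' hD')

end Coupling

section Hamming

variable {V Q : Type*} [Fintype V] [DecidableEq V] [DecidableEq Q]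

lemma hammingDist_update_update (σ τ : V → Q) (v : V) (c c' : Q) :
    (hammingDist (Function.update σ v c) (Function.update τ v c') : ℝ) =
      hammingDist σ τ - (if σ v ≠ τ v then 1 else 0) + (1 - if c = c' then 1 else 0) := by
  have key : ∀ x y : V → Q, (hammingDist x y : ℝ) =
      (if x v ≠ y v then 1 else 0) + ∑ u ∈ univ.erase v, if x u ≠ y u then 1 else 0 := by
    intro x y
    rw [Finset.add_sum_erase _ (fun u => if x u ≠ y u then (1 : ℝ) else 0) (Finset.mem_univ v),
      Finset.sum_boole]
    rfl
  have hrest : (∑ u ∈ univ.erase v,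
      if Function.update σ v c u ≠ Function.update τ v c' u then (1 : ℝ) else 0) =
      ∑ u ∈ univ.erase v, if σ u ≠ τ u then 1 else 0 := by
    refine Finset.sum_congr rfl fun u hu => ?_
    have : u ≠ v := Finset.ne_of_mem_erase hu
    simp [this]
  rw [key (Function.update σ v c), key σ τ, hrest]
  rw [Function.update_self, Function.update_self]
  by_cases h : c = c' <;>
    simp only [h, ne_eq, not_true, not_false_eq_true, if_true, if_false] <;> ring

/-- Expected Hamming distance after the spins at `v` are redrawn from a joint law `D`. -/
lemma sum_mul_hammingDist_update [Fintype Q] (σ τ : V → Q) (v : V) (D : Q → Q → ℝ)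
    (hD : ∑ c, ∑ c', D c c' = 1) :
    ∑ c, ∑ c', D c c' *
        (hammingDist (Function.update σ v c) (Function.update τ v c') : ℝ) =
      hammingDist σ τ - (if σ v ≠ τ v then 1 else 0) + (1 - ∑ c, D c c) := by
  simp only [hammingDist_update_update, mul_add, mul_sub, Finset.sum_add_distrib,
    Finset.sum_sub_distrib, ← Finset.sum_mul, hD]
  simp

end Hamming

section Marginal

variable {V Q : Type*} [Fintype V] [Fintype Q] (G : SimpleGraph V) [DecidableRel G.Adj]
  (φ : V → Q → WithBot ℝ) (ψ : V → V → Q → Q → WithBot ℝ)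

lemma expB_nonneg (x : WithBot ℝ) : 0 ≤ expB x := by
  induction x using WithBot.recBotCoe with
  | bot => exact le_rfl
  | coe x => exact (Real.exp_pos x).le

lemma margW_nonneg (v : V) (τ : V → Q) (c : Q) : 0 ≤ margW G φ ψ v τ c :=
  div_nonneg (expB_nonneg _) (Finset.sum_nonneg fun _ _ => expB_nonneg _)

lemma sum_margW {v : V} {τ : V → Q}
    (h : 0 < ∑ a, expB (φ v a + ∑ u ∈ G.neighborFinset v, ψ u v (τ u) a)) :
    ∑ c, margW G φ ψ v τ c = 1 := by
  simp only [margW]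
  rw [← Finset.sum_div, div_self h.ne']

lemma margW_congr {v : V} {σ τ : V → Q} (h : ∀ u, G.Adj v u → σ u = τ u) :
    margW G φ ψ v σ = margW G φ ψ v τ := by
  have key : ∀ a, ∑ u ∈ G.neighborFinset v, ψ u v (σ u) a =
      ∑ u ∈ G.neighborFinset v, ψ u v (τ u) a := fun a =>
    Finset.sum_congr rfl fun u hu => by rw [h u ((G.mem_neighborFinset v u).1 hu)]
  funext c
  simp only [margW, key]

lemma margW_eq_of_not_inS (G' : SimpleGraph V) [DecidableRel G'.Adj]
    (ψ' : V → V → Q → Q → WithBot ℝ)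
    (hagree : ∀ u v, G.Adj u v → G'.Adj u v → ∀ c c', ψ u v c c' = ψ' u v c c')
    {v : V} (hv : ¬ inS G G' v) (τ : V → Q) :
    margW G φ ψ v τ = margW G' φ ψ' v τ := by
  have hadj : ∀ u, G.Adj v u ↔ G'.Adj v u := by
    intro u
    by_contra h
    exact hv ⟨u, by tauto⟩
  have hN : G.neighborFinset v = G'.neighborFinset v := by
    ext u
    simp [hadj u]
  have key : ∀ a, ∑ u ∈ G.neighborFinset v, ψ u v (τ u) a =
      ∑ u ∈ G'.neighborFinset v, ψ' u v (τ u) a := by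
    intro a
    rw [hN]
    refine Finset.sum_congr rfl fun u hu => ?_
    have hu' : G'.Adj v u := (G'.mem_neighborFinset v u).1 hu
    exact hagree u v ((hadj u).2 hu').symm hu'.symm _ _
  funext c
  simp only [margW, key]

lemma influence_nonneg (u v : V) : 0 ≤ influence G φ ψ u v := by
  unfold influence
  split_ifs
  · refine Real.sSup_nonneg ?_
    rintro _ ⟨σ, τ, -, rfl⟩
    exact tvDist_nonneg _ _
  · exact le_rfl

lemma tvDist_margW_le_influence {u : V} {σ τ : V → Q} (h : ∀ w, w ≠ u → σ w = τ w) (v : V) :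
    tvDist (margW G φ ψ v σ) (margW G φ ψ v τ) ≤ influence G φ ψ u v := by
  unfold influence
  split_ifs with huv
  · refine le_csSup ?_ ⟨σ, τ, h, rfl⟩
    refine ((Set.finite_range fun p : (V → Q) × (V → Q) =>
      tvDist (margW G φ ψ v p.1) (margW G φ ψ v p.2)).subset ?_).bddAbove
    rintro _ ⟨σ', τ', -, rfl⟩
    exact ⟨(σ', τ'), rfl⟩
  · rw [margW_congr G φ ψ fun w hw => h w ?_, tvDist_self]
    rintro rfl
    exact huv hw.symm

/-- The marginals at `v` under two configurations differ in total variation by at most the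
total influence on `v` of the vertices where the configurations disagree. -/
lemma tvDist_margW_le_sum_influence [DecidableEq Q] (σ τ : V → Q) (v : V) :
    tvDist (margW G φ ψ v σ) (margW G φ ψ v τ) ≤
      ∑ u with σ u ≠ τ u, influence G φ ψ u v := by
  classical
  have key : ∀ s : Finset V,
      tvDist (margW G φ ψ v σ) (margW G φ ψ v fun u => if u ∈ s then τ u else σ u) ≤
        ∑ u ∈ s, influence G φ ψ u v := by
    intro s
    induction s using Finset.induction_on with
    | empty => simp [tvDist_self]
    | insert a s ha ih =>
      rw [Finset.sum_insert ha, add_comm]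
      refine (tvDist_triangle _ _ _).trans
        (add_le_add ih (tvDist_margW_le_influence G φ ψ (fun w hw => ?_) v))
      simp [hw]
  convert key {u | σ u ≠ τ u} using 3
  funext u
  by_cases h : σ u = τ u <;> simp [h]

end Marginal

/-- The vertices incident to a changed edge number at most twice the changed edges. -/
lemma card_inS_le {V : Type*} [Fintype V] [DecidableEq V] (G G' : SimpleGraph V)
    [Fintype G.edgeSet] [Fintype G'.edgeSet] [DecidablePred (inS G G')] :
    #{v | inS G G' v} ≤ 2 * #(symmDiff G.edgeFinset G'.edgeFinset) := by
  have hsub : ({v | inS G G' v} : Finset V) ⊆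
      (symmDiff G.edgeFinset G'.edgeFinset).biUnion Sym2.toFinset := by
    intro v hv
    obtain ⟨u, hu⟩ := (Finset.mem_filter.1 hv).2
    refine Finset.mem_biUnion.2 ⟨s(v, u), ?_, by simp⟩
    simpa [Finset.mem_symmDiff] using hu
  refine (Finset.card_le_card hsub).trans ?_
  rw [mul_comm]
  refine Finset.card_biUnion_le_card_mul _ _ _ fun e _ => ?_
  rw [Sym2.card_toFinset]
  split_ifs <;> omega

/-- For the one-step local coupling for edge update between the Gibbs sampling
chains on `I = (V,E,Q,Φ)` and `I' = (V,E',Q,Φ')` (same vertex set, potentials agreeing on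
`V ∪ (E∩E')`, `|E ⊕ E'| ≤ L`), if `I'` satisfies the Dobrushin–Shlosman condition with
constant `δ > 0`, then for all `σ, τ`:
`E[H(X_t,Y_t) | X_{t−1} = σ ∧ Y_{t−1} = τ] ≤ (1 − δ/n)·H(σ,τ) + 4L/n`.
The local coupling `Dloc v` is the independent product of the two conditional marginals when
`v ∈ S` (incident to a changed edge), and an optimal coupling of the `I`-marginals otherwise. -/
theorem edge_update_one_step_contraction
    {V Q : Type*} [Fintype V] [DecidableEq V] [Nonempty V]
    [Fintype Q] [DecidableEq Q] [Nonempty Q]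
    (G G' : SimpleGraph V) [DecidableRel G.Adj] [DecidableRel G'.Adj]
    [Fintype G.edgeSet] [Fintype G'.edgeSet]
    (φ : V → Q → WithBot ℝ) (ψ ψ' : V → V → Q → Q → WithBot ℝ)
    (hψsym : ∀ u v c c', ψ u v c c' = ψ v u c' c)
    (hψ'sym : ∀ u v c c', ψ' u v c c' = ψ' v u c' c)
    (hQ2 : 2 ≤ Fintype.card Q)
    (hagree : ∀ u v, G.Adj u v → G'.Adj u v → ∀ c c', ψ u v c c' = ψ' u v c c')
    (hpos : ∀ (v : V) (τ : V → Q),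
      0 < ∑ a, expB (φ v a + ∑ u ∈ G.neighborFinset v, ψ u v (τ u) a))
    (hpos' : ∀ (v : V) (τ : V → Q),
      0 < ∑ a, expB (φ v a + ∑ u ∈ G'.neighborFinset v, ψ' u v (τ u) a))
    (δ L : ℝ) (hδ : 0 < δ)
    (hDob' : DobrushinCondition G' φ ψ' δ)
    (hL : ((symmDiff G.edgeFinset G'.edgeFinset).card : ℝ) ≤ L)
    (Dloc : V → (V → Q) → (V → Q) → Q → Q → ℝ)
    (hS : ∀ (v : V) (σ τ : V → Q), inS G G' v →
      ∀ c c', Dloc v σ τ c c' = margW G φ ψ v σ c * margW G' φ ψ' v τ c')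
    (hOpt : ∀ (v : V) (σ τ : V → Q), ¬ inS G G' v →
      IsOptimalCoupling (margW G φ ψ v σ) (margW G φ ψ v τ) (Dloc v σ τ)) :
    ∀ σ τ : V → Q,
      (Fintype.card V : ℝ)⁻¹ * ∑ v, ∑ c, ∑ c',
          Dloc v σ τ c c' *
            (hammingDist (Function.update σ v c) (Function.update τ v c') : ℝ)
        ≤ (1 - δ / (Fintype.card V : ℝ)) * (hammingDist σ τ : ℝ) +
            4 * L / (Fintype.card V : ℝ) := by
  intro σ τ
  classical
  have hvertex : ∀ v, ∑ c, ∑ c', Dloc v σ τ c c' *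
        (hammingDist (Function.update σ v c) (Function.update τ v c') : ℝ) ≤
      hammingDist σ τ - (if σ v ≠ τ v then 1 else 0) + ((if inS G G' v then 1 else 0) +
        ∑ u with σ u ≠ τ u, influence G' φ ψ' u v) := by
    intro v
    have hσ := sum_margW G φ ψ (hpos v σ)
    by_cases hv : inS G G' v
    · have hτ := sum_margW G' φ ψ' (hpos' v τ)
      have hdiag : 0 ≤ ∑ c, Dloc v σ τ c c := Finset.sum_nonneg fun c _ => by
        rw [hS v σ τ hv]
        exact mul_nonneg (margW_nonneg ..) (margW_nonneg ..)
      have hinf : 0 ≤ ∑ u with σ u ≠ τ u, influence G' φ ψ' u v :=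
        Finset.sum_nonneg fun u _ => influence_nonneg G' φ ψ' u v
      rw [sum_mul_hammingDist_update, if_pos hv]
      · linarith
      · simp only [hS v σ τ hv, ← Finset.mul_sum, hτ, mul_one, hσ]
    · have hτ := sum_margW G φ ψ (hpos v τ)
      have hopt := hOpt v σ τ hv
      have hdiag := hopt.one_sub_tvDist_le (margW_nonneg G φ ψ v σ) (margW_nonneg G φ ψ v τ) hσ hτ
      have htv := tvDist_margW_le_sum_influence G' φ ψ' σ τ v
      rw [← margW_eq_of_not_inS G φ ψ G' ψ' hagree hv σ,
        ← margW_eq_of_not_inS G φ ψ G' ψ' hagree hv τ] at htv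
      rw [sum_mul_hammingDist_update, if_neg hv]
      · linarith
      · simp only [hopt.1.2.1, hσ]
  have hinfl : ∑ v, ∑ u with σ u ≠ τ u, influence G' φ ψ' u v ≤ hammingDist σ τ * (1 - δ) := by
    rw [Finset.sum_comm]
    refine (Finset.sum_le_sum fun u _ => hDob' u).trans_eq ?_
    rw [Finset.sum_const, nsmul_eq_mul]
    rfl
  have hcard : ∑ v, (if inS G G' v then (1 : ℝ) else 0) ≤ 2 * L := by
    have h : ((#{v | inS G G' v} : ℕ) : ℝ) ≤ 2 * #(symmDiff G.edgeFinset G'.edgeFinset) :=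
      mod_cast card_inS_le G G'
    rw [Finset.sum_boole]
    linarith
  have hL0 : 0 ≤ L := (Nat.cast_nonneg _).trans hL
  have hham : ∑ v, (if σ v ≠ τ v then (1 : ℝ) else 0) = hammingDist σ τ := by
    rw [Finset.sum_boole]
    rfl
  have hn : (0 : ℝ) < Fintype.card V := mod_cast Fintype.card_pos
  have hsum := Finset.sum_le_sum fun v (_ : v ∈ univ) => hvertex v
  rw [Finset.sum_add_distrib, Finset.sum_sub_distrib, Finset.sum_add_distrib, hham,
    Finset.sum_const, Finset.card_univ, nsmul_eq_mul] at hsum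
  rw [inv_mul_le_iff₀ hn]
  calc _ ≤ _ := hsum
    _ ≤ (Fintype.card V - δ) * hammingDist σ τ + 4 * L := by linarith
    _ = _ := by field_simp
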